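/- arXiv:1410.5794 — 2 statements merged into one kernel-verified Lean document; each statement's English description precedes it below -/
import Mathlib

section
/- Let M be a complex matrix, let A=(a_1,...,a_s) and B=(b_1,...,b_s) be tuples of distinct row and column indices of equal length, let â, a, ā be three further distinct row indices not occurring in A, and b̂, b, b̄ three further distinct column indices not occurring in B. Then M^{A,B}·M^{âaāA,b̂bb̄B} + M^{aāA,bb̄B}·M^{âA,b̂B} − M^{aA,bB}·M^{âāA,b̂b̄B} − M^{āA,b̄B}·M^{âaA,b̂bB} + M^{āA,bB}·M^{âaA,b̂b̄B} + M^{aA,b̄B}·M^{âāA,b̂bB} = 0. -/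
/-- The minor `M^{A,B}` of a matrix `M` with rows selected by the tuple `A`
and columns selected by the tuple `B`; for `s = 0` this equals `1`. -/
noncomputable def minor {I J : Type*} (M : I → J → ℂ) {s : ℕ}
    (A : Fin s → I) (B : Fin s → J) : ℂ :=
  Matrix.det (Matrix.of fun α β => M (A α) (B β))

open Matrix in
theorem minor_schur {I J : Type*} (M : I → J → ℂ) {s k n : ℕ}
    (A : Fin s → I) (B : Fin s → J) (h : minor M A B ≠ 0)
    (f : Fin k → I) (g : Fin k → J) (A_one : Fin n → I) (B_one : Fin n → J)
    (e : Fin k ⊕ Fin s ≃ Fin n)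
    (hA : ∀ i, A_one (e i) = Sum.elim f A i) (hB : ∀ i, B_one (e i) = Sum.elim g B i) :
    minor M A_one B_one = minor M A B * minor (fun i j => M i j -
      ((Matrix.of fun (_ : Unit) β => M i (B β)) *
        (Matrix.of fun α β => M (A α) (B β))⁻¹ *
        (Matrix.of fun α (_ : Unit) => M (A α) j)) () ()) f g := by
  set D : Matrix (Fin s) (Fin s) ℂ := Matrix.of fun α β => M (A α) (B β) with hD
  have hu : IsUnit D.det := by
    rw [isUnit_iff_ne_zero]; exact h
  have : Invertible D := Matrix.invertibleOfIsUnitDet D hu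
  have h1 : minor M A_one B_one = (Matrix.fromBlocks
      (Matrix.of fun i j => M (f i) (g j)) (Matrix.of fun i β => M (f i) (B β))
      (Matrix.of fun α j => M (A α) (g j)) D).det := by
    unfold minor
    rw [← Matrix.det_submatrix_equiv_self e]
    congr 1
    ext i j
    rcases i with i | i <;> rcases j with j | j <;> simp [hA, hB, hD]
  rw [h1, Matrix.det_fromBlocks₂₂]
  unfold minor
  congr 2
  ext i j
  simp [Matrix.mul_apply]

theorem six_term_of_ne {I J : Type*} (M : I → J → ℂ) {s : ℕ}
    (A : Fin s → I) (B : Fin s → J)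
    (ahat a abar : I) (bhat b bbar : J) (h : minor M A B ≠ 0) :
    minor M A B *
        minor M (Fin.cons ahat (Fin.cons a (Fin.cons abar A)))
          (Fin.cons bhat (Fin.cons b (Fin.cons bbar B)))
      + minor M (Fin.cons a (Fin.cons abar A)) (Fin.cons b (Fin.cons bbar B)) *
          minor M (Fin.cons ahat A) (Fin.cons bhat B)
      - minor M (Fin.cons a A) (Fin.cons b B) *
          minor M (Fin.cons ahat (Fin.cons abar A)) (Fin.cons bhat (Fin.cons bbar B))
      - minor M (Fin.cons abar A) (Fin.cons bbar B) *
          minor M (Fin.cons ahat (Fin.cons a A)) (Fin.cons bhat (Fin.cons b B))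
      + minor M (Fin.cons abar A) (Fin.cons b B) *
          minor M (Fin.cons ahat (Fin.cons a A)) (Fin.cons bhat (Fin.cons bbar B))
      + minor M (Fin.cons a A) (Fin.cons bbar B) *
          minor M (Fin.cons ahat (Fin.cons abar A)) (Fin.cons bhat (Fin.cons b B))
      = 0 := by
  let e1 : Fin 1 ⊕ Fin s ≃ Fin (s+1) := finSumFinEquiv.trans (finCongr (by omega))
  let e2 : Fin 2 ⊕ Fin s ≃ Fin (s+1+1) := finSumFinEquiv.trans (finCongr (by omega))
  let e3 : Fin 3 ⊕ Fin s ≃ Fin (s+1+1+1) := finSumFinEquiv.trans (finCongr (by omega))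
  have E1 : ∀ j, e1 (Sum.inr j) = j.succ := fun j => by
    ext; simp [e1]
  have E2 : ∀ j, e2 (Sum.inr j) = j.succ.succ := fun j => by
    ext; simp [e2]
  have E3 : ∀ j, e3 (Sum.inr j) = j.succ.succ.succ := fun j => by
    ext; simp [e3]
  have F1 : ∀ {K : Type _} (x : K) (C : Fin s → K) (i),
      (Fin.cons x C : Fin (s+1) → K) (e1 i) = Sum.elim ![x] C i := by
    rintro K x C (i | i)
    · fin_cases i; rfl
    · rw [E1]; rfl
  have F1_one : ∀ {K : Type _} (x : K) (C : Fin s → K) (i),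
      (Fin.cons x C : Fin (s+1) → K) (e1 i) = Sum.elim ![x] C i := by
    rintro K x C (i | i)
    · fin_cases i; rfl
    · rw [E1]; rfl
  have F2 : ∀ {K : Type _} (x y : K) (C : Fin s → K) (i),
      (Fin.cons x (Fin.cons y C : Fin (s+1) → K) : Fin (s+1+1) → K) (e2 i)
        = Sum.elim ![x, y] C i := by
    rintro K x y C (i | i)
    · fin_cases i <;> rfl
    · rw [E2]; rfl
  have F2_one : ∀ {K : Type _} (x y : K) (C : Fin s → K) (i),
      (Fin.cons x (Fin.cons y C : Fin (s+1) → K) : Fin (s+1+1) → K) (e2 i)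
        = Sum.elim ![x, y] C i := by
    rintro K x y C (i | i)
    · fin_cases i <;> rfl
    · rw [E2]; rfl
  have F3 : ∀ {K : Type _} (x y z : K) (C : Fin s → K) (i),
      (Fin.cons x (Fin.cons y (Fin.cons z C : Fin (s+1) → K) : Fin (s+1+1) → K) :
        Fin (s+1+1+1) → K) (e3 i) = Sum.elim ![x, y, z] C i := by
    rintro K x y z C (i | i)
    · fin_cases i <;> rfl
    · rw [E3]; rfl
  have F3_one : ∀ {K : Type _} (x y z : K) (C : Fin s → K) (i),
      (Fin.cons x (Fin.cons y (Fin.cons z C : Fin (s+1) → K) : Fin (s+1+1) → K) :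
        Fin (s+1+1+1) → K) (e3 i) = Sum.elim ![x, y, z] C i := by
    rintro K x y z C (i | i)
    · fin_cases i <;> rfl
    · rw [E3]; rfl
  have G1 := fun x y => minor_schur M A B h ![x] ![y] _ _ e1 (F1 x A) (F1_one y B)
  have G2 := fun x x_one y y_one => minor_schur M A B h ![x, x_one] ![y, y_one] _ _ e2
    (F2 x x_one A) (F2_one y y_one B)
  have G3 := fun x x_one x_two y y_one y_two => minor_schur M A B h ![x, x_one, x_two] ![y, y_one, y_two] _ _ e3
    (F3 x x_one x_two A) (F3_one y y_one y_two B)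
  simp only [G1, G2, G3]
  generalize (fun i j => M i j - _ : I → J → ℂ) = S
  generalize minor M A B = d
  simp only [minor, Matrix.det_fin_three, Matrix.det_fin_two, Matrix.det_fin_one, Matrix.of_apply,
    Matrix.cons_val]
  ring

/-- The six-term identity
`M^{A,B}·M^{âaāA,b̂bb̄B} + M^{aāA,bb̄B}·M^{âA,b̂B} − M^{aA,bB}·M^{âāA,b̂b̄B}
 − M^{āA,b̄B}·M^{âaA,b̂bB} + M^{āA,bB}·M^{âaA,b̂b̄B} + M^{aA,b̄B}·M^{âāA,b̂bB} = 0`. -/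
theorem six_term_minor_identity {I J : Type*} (M : I → J → ℂ) {s : ℕ}
    (A : Fin s → I) (B : Fin s → J)
    (hA : Function.Injective A) (hB : Function.Injective B)
    (ahat a abar : I) (bhat b bbar : J)
    (hr1 : ahat ≠ a) (hr2 : ahat ≠ abar) (hr3 : a ≠ abar)
    (hrA1 : ∀ α, ahat ≠ A α) (hrA2 : ∀ α, a ≠ A α) (hrA3 : ∀ α, abar ≠ A α)
    (hc1 : bhat ≠ b) (hc2 : bhat ≠ bbar) (hc3 : b ≠ bbar)
    (hcB1 : ∀ β, bhat ≠ B β) (hcB2 : ∀ β, b ≠ B β) (hcB3 : ∀ β, bbar ≠ B β) :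
    minor M A B *
        minor M (Fin.cons ahat (Fin.cons a (Fin.cons abar A)))
          (Fin.cons bhat (Fin.cons b (Fin.cons bbar B)))
      + minor M (Fin.cons a (Fin.cons abar A)) (Fin.cons b (Fin.cons bbar B)) *
          minor M (Fin.cons ahat A) (Fin.cons bhat B)
      - minor M (Fin.cons a A) (Fin.cons b B) *
          minor M (Fin.cons ahat (Fin.cons abar A)) (Fin.cons bhat (Fin.cons bbar B))
      - minor M (Fin.cons abar A) (Fin.cons bbar B) *
          minor M (Fin.cons ahat (Fin.cons a A)) (Fin.cons bhat (Fin.cons b B))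
      + minor M (Fin.cons abar A) (Fin.cons b B) *
          minor M (Fin.cons ahat (Fin.cons a A)) (Fin.cons bhat (Fin.cons bbar B))
      + minor M (Fin.cons a A) (Fin.cons bbar B) *
          minor M (Fin.cons ahat (Fin.cons abar A)) (Fin.cons bhat (Fin.cons b B))
      = 0 := by
  classical
  let N : ℂ → I → J → ℂ := fun t i j => M i j + t * ∑ α, if i = A α ∧ j = B α then 1 else 0
  have hN0 : N 0 = M := by funext i j; simp [N]
  have hc : ∀ {n : ℕ} (A_one : Fin n → I) (B_one : Fin n → J),
      Continuous fun t => minor (N t) A_one B_one := by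
    intro n A_one B_one
    unfold minor
    refine Continuous.matrix_det ?_
    refine continuous_matrix fun i j => ?_
    simp only [Matrix.of_apply, N]
    fun_prop
  have hAB : ∀ t, minor (N t) A B
      = (Matrix.charpoly (-(Matrix.of fun α β => M (A α) (B β)))).eval t := by
    intro t
    rw [Matrix.eval_charpoly]
    unfold minor
    congr 1
    ext i j
    have : (∑ α, if i = α ∧ j = α then (1 : ℂ) else 0) = if i = j then 1 else 0 := by
      by_cases hij : i = j
      · subst hij; simp
      · rw [if_neg hij]
        refine Finset.sum_eq_zero fun x _ => if_neg ?_
        rintro ⟨rfl, rfl⟩; exact hij rfl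
    simp only [N, Matrix.of_apply, hA.eq_iff, hB.eq_iff, this]
    simp [Matrix.scalar_apply, Matrix.diagonal_apply, add_comm]
  have hdense : Dense {t : ℂ | minor (N t) A B ≠ 0} := by
    have hfin : Set.Finite {t : ℂ | minor (N t) A B = 0} := by
      simp only [hAB]
      exact Polynomial.finite_setOfPred_isRoot (Matrix.charpoly_monic _).ne_zero
    exact Set.Countable.dense_compl ℂ (Set.Finite.countable hfin)
  let F : ℂ → ℂ := fun M_one => (fun M : I → J → ℂ =>
    minor M A B *
        minor M (Fin.cons ahat (Fin.cons a (Fin.cons abar A)))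
          (Fin.cons bhat (Fin.cons b (Fin.cons bbar B)))
      + minor M (Fin.cons a (Fin.cons abar A)) (Fin.cons b (Fin.cons bbar B)) *
          minor M (Fin.cons ahat A) (Fin.cons bhat B)
      - minor M (Fin.cons a A) (Fin.cons b B) *
          minor M (Fin.cons ahat (Fin.cons abar A)) (Fin.cons bhat (Fin.cons bbar B))
      - minor M (Fin.cons abar A) (Fin.cons bbar B) *
          minor M (Fin.cons ahat (Fin.cons a A)) (Fin.cons bhat (Fin.cons b B))
      + minor M (Fin.cons abar A) (Fin.cons b B) *
          minor M (Fin.cons ahat (Fin.cons a A)) (Fin.cons bhat (Fin.cons bbar B))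
      + minor M (Fin.cons a A) (Fin.cons bbar B) *
          minor M (Fin.cons ahat (Fin.cons abar A)) (Fin.cons bhat (Fin.cons b B))) (N M_one)
  have hF : F = fun _ => 0 := by
    refine Continuous.ext_on hdense ?_ continuous_const ?_
    · have hcc := @hc
      simp only [F]
      fun_prop
    · intro t ht
      exact six_term_of_ne (N t) A B ahat a abar bhat b bbar ht
  have := congrFun hF 0
  simp only [F, hN0] at this
  exact this
end

section
/- Let a = (α⁰,α¹,α²,α³) and b = (β⁰,β¹,β²,β³) be vectors in ℂ⁴ all of whose components are nonzero, and consider the hexagon in ℂP³ with vertex homogeneous coordinates x¹ = (0,0,1,0), x² = (1,0,0,0), x³ = a, x⁴ = (0,0,0,1), x⁵ = (0,1,0,0), x⁶ = b. Set γ⁰² = α⁰β² − α²β⁰ and γ¹³ = α¹β³ − α³β¹, and define the symmetric 4×4 matrix B (indices 0..3) by B₀₂ = B₂₀ = γ¹³, B₁₃ = B₃₁ = γ⁰², B₀₀ = −(β²/β⁰)γ¹³, B₁₁ = −(α³/α¹)γ⁰², B₂₂ = −(α⁰/α²)γ¹³, B₃₃ = −(β¹/β³)γ⁰², all other entries zero.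 Then: (i) for every i ∈ {1,...,6} and every j ∈ {i+2, i+3, i+4} (indices modulo 6), (x^j)ᵀ B x^i = 0, so the polarity defined by B maps each extended edge of the hexagon to the opposite edge; and (ii) if moreover (γ⁰², γ¹³) ≠ (0,0), then every symmetric 4×4 complex matrix B′ satisfying (x^j)ᵀ B′ x^i = 0 for all i and all j ∈ {i+2,i+3,i+4} (mod 6) is a scalar multiple of B; in particular the correlation interchanging opposite edges of the hexagon exists, is unique, and is a polarity. -/
open Matrix

/-- The symmetric matrix `B` of the polarity associated with the hexagon with
vertices `x¹ = (0,0,1,0)`, `x² = (1,0,0,0)`, `x³ = a`, `x⁴ = (0,0,0,1)`,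
`x⁵ = (0,1,0,0)`, `x⁶ = b`, where `γ⁰² = α⁰β² − α²β⁰` and `γ¹³ = α¹β³ − α³β¹`. -/
noncomputable def hexB (α0 α1 α2 α3 β0 β1 β2 β3 : ℂ) : Matrix (Fin 4) (Fin 4) ℂ :=
  !![-(β2 / β0) * (α1 * β3 - α3 * β1), 0, α1 * β3 - α3 * β1, 0;
     0, -(α3 / α1) * (α0 * β2 - α2 * β0), 0, α0 * β2 - α2 * β0;
     α1 * β3 - α3 * β1, 0, -(α0 / α2) * (α1 * β3 - α3 * β1), 0;
     0, α0 * β2 - α2 * β0, 0, -(β1 / β3) * (α0 * β2 - α2 * β0)]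

/-- The vertices `x¹, …, x⁶` of the hexagon, indexed by `Fin 6`
(so `hexX … i` is the vertex `x^{i+1}`);  index arithmetic is modulo 6. -/
noncomputable def hexX (α0 α1 α2 α3 β0 β1 β2 β3 : ℂ) : Fin 6 → Fin 4 → ℂ :=
  ![![0, 0, 1, 0], ![1, 0, 0, 0], ![α0, α1, α2, α3],
    ![0, 0, 0, 1], ![0, 1, 0, 0], ![β0, β1, β2, β3]]

/-- (i) The polarity defined by `B = hexB …` maps every vertex `x^i` of the hexagon
to the opposite plane `π^{i+3}`, i.e. `(x^j)ᵀ B x^i = 0` for `j ∈ {i+2, i+3, i+4}`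
(mod 6), so each extended edge is mapped to the opposite edge; and
(ii) if `(γ⁰², γ¹³) ≠ (0,0)` then any symmetric matrix `B'` with this property is a
scalar multiple of `B`: the correlation interchanging opposite edges of the hexagon
exists, is unique, and is a polarity. -/
theorem hexagon_polarity (α0 α1 α2 α3 β0 β1 β2 β3 : ℂ)
    (hα0 : α0 ≠ 0) (hα1 : α1 ≠ 0) (hα2 : α2 ≠ 0) (hα3 : α3 ≠ 0)
    (hβ0 : β0 ≠ 0) (hβ1 : β1 ≠ 0) (hβ2 : β2 ≠ 0) (hβ3 : β3 ≠ 0) :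
    (∀ i j : Fin 6, (j = i + 2 ∨ j = i + 3 ∨ j = i + 4) →
        hexX α0 α1 α2 α3 β0 β1 β2 β3 j ⬝ᵥ
          (hexB α0 α1 α2 α3 β0 β1 β2 β3).mulVec (hexX α0 α1 α2 α3 β0 β1 β2 β3 i) = 0)
      ∧ (¬(α0 * β2 - α2 * β0 = 0 ∧ α1 * β3 - α3 * β1 = 0) →
          ∀ B' : Matrix (Fin 4) (Fin 4) ℂ, B'.IsSymm →
            (∀ i j : Fin 6, (j = i + 2 ∨ j = i + 3 ∨ j = i + 4) →
              hexX α0 α1 α2 α3 β0 β1 β2 β3 j ⬝ᵥ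
                B'.mulVec (hexX α0 α1 α2 α3 β0 β1 β2 β3 i) = 0) →
            ∃ c : ℂ, B' = c • hexB α0 α1 α2 α3 β0 β1 β2 β3) := by
  constructor
  · intro i j h
    fin_cases i <;> rcases h with rfl | rfl | rfl <;>
      simp [hexX, hexB, Matrix.mulVec, dotProduct, Fin.sum_univ_four] <;>
      field_simp <;> ring
  · intro hne B hS h
    have h24 := h 0 3 (by decide)
    have h25 := h 0 4 (by decide)
    have h04 := h 1 3 (by decide)
    have h05 := h 1 4 (by decide)
    have h13 := h 2 0 (by decide)
    have h26 := h 5 1 (by decide)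
    have h35 := h 2 4 (by decide)
    have h46 := h 5 3 (by decide)
    have h36 := h 5 2 (by decide)
    have s01 := hS.apply 0 1
    have s02 := hS.apply 0 2
    have s03 := hS.apply 0 3
    have s12 := hS.apply 1 2
    have s13 := hS.apply 1 3
    have s23 := hS.apply 2 3
    simp [hexX, Matrix.mulVec, dotProduct, Fin.sum_univ_four] at h24 h25 h04 h05 h13 h26 h35 h46 h36
    have z10 : B 1 0 = 0 := by grind
    have z01 : B 0 1 = 0 := by grind
    have z30 : B 3 0 = 0 := by grind
    have z03 : B 0 3 = 0 := by grind
    have z12 : B 1 2 = 0 := by grind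
    have z21 : B 2 1 = 0 := by grind
    have z32 : B 3 2 = 0 := by grind
    have z23 : B 2 3 = 0 := by grind
    rw [s02, z21, z23] at h13
    rw [z01, z03] at h26
    rw [z10, z12] at h35
    rw [s13, z30, z32] at h46
    rw [z01, z03, z10, z12, z21, z23, z30, z32, s02, s13] at h36
    have key : B 0 2 * (α0 * β2 - α2 * β0) = B 1 3 * (α1 * β3 - α3 * β1) := by
      linear_combination -h36 + α0 * h26 + β2 * h13 + β1 * h35 + α3 * h46
    have e00 : B 0 0 = -(β2 / β0) * B 0 2 := by
      field_simp; linear_combination h26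
    have e11 : B 1 1 = -(α3 / α1) * B 1 3 := by
      field_simp; linear_combination h35
    have e22 : B 2 2 = -(α0 / α2) * B 0 2 := by
      field_simp; linear_combination h13
    have e33 : B 3 3 = -(β1 / β3) * B 1 3 := by
      field_simp; linear_combination h46
    obtain ⟨c, hc1, hc2⟩ : ∃ c, B 0 2 = c * (α1 * β3 - α3 * β1) ∧
        B 1 3 = c * (α0 * β2 - α2 * β0) := by
      by_cases h0 : α0 * β2 - α2 * β0 = 0
      · have h1 : α1 * β3 - α3 * β1 ≠ 0 := fun h1 => hne ⟨h0, h1⟩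
        refine ⟨B 0 2 / (α1 * β3 - α3 * β1), (div_mul_cancel₀ _ h1).symm, ?_⟩
        rw [h0, mul_zero] at key ⊢
        exact (mul_eq_zero.mp key.symm).resolve_right h1
      · refine ⟨B 1 3 / (α0 * β2 - α2 * β0), ?_, (div_mul_cancel₀ _ h0).symm⟩
        rw [div_mul_eq_mul_div, eq_div_iff h0, key]
    refine ⟨c, ?_⟩
    ext i j
    fin_cases i <;> fin_cases j <;>
      simp [hexB, z01, z03, z10, z12, z21, z23, z30, z32, s02, s13, e00, e11, e22, e33, hc1, hc2] <;>
      ring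
end
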